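/- Let ψ be the Lévy characteristic associated with the triplet (a, σ, M), let d ≥ 1, and let f_1, …, f_n : ℝ^d → ℝ^L be measurable functions such that for every pair (l, j) the function x ↦ ψ(f_l(x) − f_j(x)) is integrable on ℝ^d. Then the functional f ↦ ∫_{ℝ^d} ψ(f(x)) dx is conditionally positive definite in f: for all z_1, …, z_n ∈ ℂ with Σ_{j=1}^n z_j = 0, the sum Σ_{l,j=1}^n (∫_{ℝ^d} ψ(f_l(x) − f_j(x)) dx) · z_l · conj(z_j) is a nonnegative real number. -/

import Mathlib

open MeasureTheory Complex ComplexOrder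

/-- The Lévy characteristic associated with the triplet `(a, σ, M)`:
`ψ(t) = i a·t − (σt·σt)/2 + ∫ (e^{i t·s} − 1) dM(s)`. -/
noncomputable def levyChar (L : ℕ) (a : Fin L → ℝ) (σ : Matrix (Fin L) (Fin L) ℝ)
    (M : Measure (Fin L → ℝ)) (t : Fin L → ℝ) : ℂ :=
  Complex.I * ((∑ i, a i * t i : ℝ) : ℂ) -
    (((∑ i, σ.mulVec t i * σ.mulVec t i) / 2 : ℝ) : ℂ) +
    ∫ s, (Complex.exp (Complex.I * ((∑ i, t i * s i : ℝ) : ℂ)) - 1) ∂M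

section QuadraticForm

variable {ι : Type*} [Fintype ι] {z : ι → ℂ}

lemma sum_rank_one_mul_conj_nonneg (g z : ι → ℂ) :
    0 ≤ ∑ l, ∑ j, (g l * (starRingEnd ℂ) (g j)) * z l * (starRingEnd ℂ) (z j) := by
  have h : ∑ l, ∑ j, (g l * (starRingEnd ℂ) (g j)) * z l * (starRingEnd ℂ) (z j) =
      (∑ l, g l * z l) * star (∑ l, g l * z l) := by
    rw [star_sum, Finset.sum_mul_sum]
    refine Finset.sum_congr rfl fun l _ => Finset.sum_congr rfl fun j _ => ?_
    simp only [star_mul', RCLike.star_def]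
    ring
  rw [h]
  exact mul_star_self_nonneg _

lemma sum_add_mul_conj_eq_zero (hz : ∑ j, z j = 0) (α β : ι → ℂ) :
    ∑ l, ∑ j, (α l + β j) * z l * (starRingEnd ℂ) (z j) = 0 := by
  have h : ∑ l, ∑ j, (α l + β j) * z l * (starRingEnd ℂ) (z j) =
      (∑ l, α l * z l) * (starRingEnd ℂ) (∑ j, z j) +
        (∑ l, z l) * ∑ j, β j * (starRingEnd ℂ) (z j) := by
    rw [map_sum, Finset.sum_mul_sum, Finset.sum_mul_sum, ← Finset.sum_add_distrib]
    refine Finset.sum_congr rfl fun l _ => ?_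
    rw [← Finset.sum_add_distrib]
    exact Finset.sum_congr rfl fun j _ => by ring
  rw [h, hz]
  simp

/-- Integrating a pointwise nonnegative form gives a nonnegative form. -/
lemma sum_integral_mul_conj_nonneg {X : Type*} [MeasurableSpace X] {μ : Measure X}
    {K : ι → ι → X → ℂ} (hK : ∀ l j, Integrable (K l j) μ) (z : ι → ℂ)
    (h : ∀ x, 0 ≤ ∑ l, ∑ j, K l j x * z l * (starRingEnd ℂ) (z j)) :
    0 ≤ ∑ l, ∑ j, (∫ x, K l j x ∂μ) * z l * (starRingEnd ℂ) (z j) := by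
  have hK' (l j : ι) : Integrable (fun x => K l j x * z l * (starRingEnd ℂ) (z j)) μ :=
    ((hK l j).mul_const _).mul_const _
  have e : ∑ l, ∑ j, (∫ x, K l j x ∂μ) * z l * (starRingEnd ℂ) (z j) =
      ∫ x, ∑ l, ∑ j, K l j x * z l * (starRingEnd ℂ) (z j) ∂μ := by
    rw [integral_finsetSum _ fun l _ => integrable_finsetSum _ fun j _ => hK' l j]
    refine Finset.sum_congr rfl fun l _ => ?_
    rw [integral_finsetSum _ fun j _ => hK' l j]
    refine Finset.sum_congr rfl fun j _ => ?_
    rw [integral_mul_const, integral_mul_const]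
  rw [e]
  exact integral_nonneg h

lemma sum_neg_half_sq_dist_mul_conj_nonneg {κ : Type*} [Fintype κ] (hz : ∑ j, z j = 0)
    (v : ι → κ → ℝ) :
    0 ≤ ∑ l, ∑ j, (-(((∑ i, (v l i - v j i) * (v l i - v j i)) / 2 : ℝ) : ℂ)) * z l *
      (starRingEnd ℂ) (z j) := by
  let q : ι → ℂ := fun l => -(((∑ i, v l i * v l i) / 2 : ℝ) : ℂ)
  have key (l j : ι) : -(((∑ i, (v l i - v j i) * (v l i - v j i)) / 2 : ℝ) : ℂ) =
      (q l + q j) + ∑ i, (v l i : ℂ) * (starRingEnd ℂ) (v j i : ℂ) := by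
    simp only [q, Complex.conj_ofReal]
    norm_cast
    have : ∑ i, (v l i - v j i) * (v l i - v j i) =
        ∑ i, v l i * v l i + ∑ i, v j i * v j i - 2 * ∑ i, v l i * v j i := by
      rw [Finset.mul_sum, ← Finset.sum_add_distrib, ← Finset.sum_sub_distrib]
      exact Finset.sum_congr rfl fun i _ => by ring
    rw [this]
    ring
  simp only [key]
  simp only [add_mul _ (∑ i, _), Finset.sum_add_distrib, sum_add_mul_conj_eq_zero hz, zero_add,
    Finset.sum_mul]
  simp only [Finset.sum_comm (s := (Finset.univ : Finset ι)) (t := (Finset.univ : Finset κ))]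
  exact Finset.sum_nonneg fun i _ => sum_rank_one_mul_conj_nonneg (fun l => (v l i : ℂ)) z

lemma sum_exp_sub_one_mul_conj_nonneg (hz : ∑ j, z j = 0) (θ : ι → ℝ) :
    0 ≤ ∑ l, ∑ j, (Complex.exp (Complex.I * ((θ l - θ j : ℝ) : ℂ)) - 1) * z l *
      (starRingEnd ℂ) (z j) := by
  have key (l j : ι) : Complex.exp (Complex.I * ((θ l - θ j : ℝ) : ℂ)) - 1 =
      Complex.exp (Complex.I * θ l) * (starRingEnd ℂ) (Complex.exp (Complex.I * θ j)) +
        ((-1 : ℂ) + 0) := by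
    rw [← Complex.exp_conj, ← Complex.exp_add, map_mul, Complex.conj_I, Complex.conj_ofReal]
    push_cast
    ring_nf
  have h0 := sum_add_mul_conj_eq_zero hz (fun _ => -1) (fun _ => 0)
  simp only [key, add_mul (_ * _), Finset.sum_add_distrib]
  rw [h0, add_zero]
  exact sum_rank_one_mul_conj_nonneg (fun l => Complex.exp (Complex.I * θ l)) z

end QuadraticForm

lemma integrable_exp_sub_one {κ : Type*} [Fintype κ] {M : Measure (κ → ℝ)}
    (hM : Integrable (fun s => ‖s‖) M) (t : κ → ℝ) :
    Integrable (fun s => Complex.exp (Complex.I * ((∑ i, t i * s i : ℝ) : ℂ)) - 1) M := by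
  refine (hM.const_mul (∑ i, ‖t i‖)).mono' ?_ (ae_of_all _ fun s => ?_)
  · exact Continuous.aestronglyMeasurable (by fun_prop)
  · refine (Real.norm_exp_I_mul_ofReal_sub_one_le).trans ?_
    refine (norm_sum_le _ _).trans ?_
    rw [Finset.sum_mul]
    refine Finset.sum_le_sum fun i _ => ?_
    rw [norm_mul]
    gcongr
    exact norm_le_pi_norm s i

lemma levyChar_conditionally_positive_definite {ι : Type*} [Fintype ι] {L : ℕ}
    (a : Fin L → ℝ) (σ : Matrix (Fin L) (Fin L) ℝ) {M : Measure (Fin L → ℝ)}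
    (hM : Integrable (fun s => ‖s‖) M) (t : ι → Fin L → ℝ) {z : ι → ℂ} (hz : ∑ j, z j = 0) :
    0 ≤ ∑ l, ∑ j, levyChar L a σ M (t l - t j) * z l * (starRingEnd ℂ) (z j) := by
  have drift (l j : ι) : Complex.I * ((∑ i, a i * (t l - t j) i : ℝ) : ℂ) =
      Complex.I * ((∑ i, a i * t l i : ℝ) : ℂ) + -(Complex.I * ((∑ i, a i * t j i : ℝ) : ℂ)) := by
    simp only [Pi.sub_apply, mul_sub, Finset.sum_sub_distrib, Complex.ofReal_sub]
    ring
  have h1 := sum_add_mul_conj_eq_zero hz (fun l => Complex.I * ((∑ i, a i * t l i : ℝ) : ℂ))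
    (fun j => -(Complex.I * ((∑ i, a i * t j i : ℝ) : ℂ)))
  have h2 := sum_neg_half_sq_dist_mul_conj_nonneg hz (fun l => σ.mulVec (t l))
  have h3 := sum_integral_mul_conj_nonneg
    (fun l j => integrable_exp_sub_one hM (t l - t j)) z fun s => by
      have h := sum_exp_sub_one_mul_conj_nonneg hz (fun l => ∑ i, t l i * s i)
      simpa only [Pi.sub_apply, sub_mul (t _ _), Finset.sum_sub_distrib] using h
  have h := add_nonneg h1.ge (add_nonneg h2 h3)
  simp only [← Finset.sum_add_distrib, ← add_mul] at h
  simp only [levyChar, drift, Matrix.mulVec_sub, sub_eq_add_neg (_ + _), add_assoc]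
  simpa only [add_assoc, Pi.sub_apply] using h

/-- The functional `f ↦ ∫_{ℝ^d} ψ(f(x)) dx` is conditionally positive definite:
for `z_1, …, z_n` with `Σ z_j = 0`,
`Σ_{l,j} (∫ ψ(f_l(x) − f_j(x)) dx) z_l conj(z_j) ≥ 0`. -/
theorem integral_levyChar_conditionally_positive_definite
    (L d n : ℕ) (hL : 1 ≤ L) (hd : 1 ≤ d)
    (a : Fin L → ℝ) (σ : Matrix (Fin L) (Fin L) ℝ)
    (hσsymm : σ.IsSymm) (hσpos : σ.PosSemidef)
    (M : Measure (Fin L → ℝ)) (hM0 : M {0} = 0)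
    (hMmom : ∀ k : ℕ, 1 ≤ k → Integrable (fun s => ‖s‖ ^ k) M)
    (f : Fin n → (Fin d → ℝ) → (Fin L → ℝ))
    (hf : ∀ l, Measurable (f l))
    (hint : ∀ l j : Fin n,
      Integrable (fun x => levyChar L a σ M (f l x - f j x))
        (volume : Measure (Fin d → ℝ)))
    (z : Fin n → ℂ) (hz : ∑ j, z j = 0) :
    0 ≤ ∑ l : Fin n, ∑ j : Fin n,
      (∫ x, levyChar L a σ M (f l x - f j x) ∂(volume : Measure (Fin d → ℝ))) *
        z l * (starRingEnd ℂ) (z j) := by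
  exact sum_integral_mul_conj_nonneg hint z fun x =>
    levyChar_conditionally_positive_definite a σ (by simpa using hMmom 1 le_rfl)
      (fun l => f l x) hz
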